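/- Suppose K = F₂. Then any basis S of X of orthogonal type is nice and connecting. -/

import Mathlib

/-- The graph `G(S)`. -/
def transGraph {K X : Type*} [Field K] [AddCommGroup X] [Module K X]
    (ω : X →ₗ[K] X →ₗ[K] K) (S : Set X) : SimpleGraph S :=
  SimpleGraph.fromRel (fun u v => ω u.1 v.1 ≠ 0)

/-- Affine transvections `T^{α(s)}_{s,k} : x ↦ x + k(ω(x,s) + α(s))·s`. -/
def affTransvectionSet {K X : Type*} [Field K] [AddCommGroup X] [Module K X]
    (ω : X →ₗ[K] X →ₗ[K] K) (S : Set X) (α : X → K) : Set (Equiv.Perm X) :=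
  {f | ∃ s ∈ S, ∃ k : K, k ≠ 0 ∧ ∀ x, f x = x + (k * (ω x s + α s)) • s}

/-- The affine transvection group `Tr^α(S)`. -/
def affTransvectionGroup {K X : Type*} [Field K] [AddCommGroup X] [Module K X]
    (ω : X →ₗ[K] X →ₗ[K] K) (S : Set X) (α : X → K) : Subgroup (Equiv.Perm X) :=
  Subgroup.closure (affTransvectionSet ω S α)

/-- One t-equivalence step. -/
def tStep {X : Type*} [AddCommGroup X] [Module (ZMod 2) X]
    (ω : X →ₗ[ZMod 2] X →ₗ[ZMod 2] ZMod 2) (S S' : Set X) : Prop :=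
  ∃ s ∈ S, ∃ t ∈ S, s ≠ t ∧ ω s t = 1 ∧ S' = insert (s + t) (S \ {t})

/-- t-equivalence. -/
def tEquiv {X : Type*} [AddCommGroup X] [Module (ZMod 2) X]
    (ω : X →ₗ[ZMod 2] X →ₗ[ZMod 2] ZMod 2) : Set X → Set X → Prop :=
  Relation.ReflTransGen (tStep ω)

/-- The graph `E₆`. -/
def e6Graph : SimpleGraph (Fin 6) :=
  SimpleGraph.fromRel
    (fun i j => (i, j) ∈ [((0 : Fin 6), (1 : Fin 6)), (1, 2), (2, 3), (3, 4), (2, 5)])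

/-- Orthogonal type: t-equivalent to a set `S'` such that `G(S')` is a tree
containing `E₆` as an induced subgraph. -/
def IsOrthogonalType {X : Type*} [AddCommGroup X] [Module (ZMod 2) X]
    (ω : X →ₗ[ZMod 2] X →ₗ[ZMod 2] ZMod 2) (S : Set X) : Prop :=
  ∃ S' : Set X, tEquiv ω S S' ∧ (transGraph ω S').IsTree ∧
    ∃ f : Fin 6 → S', Function.Injective f ∧
      ∀ i j, (transGraph ω S').Adj (f i) (f j) ↔ e6Graph.Adj i j

/-- A basis `S` is *nice*. -/
def IsNice {X : Type*} [AddCommGroup X] [Module (ZMod 2) X]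
    (ω : X →ₗ[ZMod 2] X →ₗ[ZMod 2] ZMod 2) (S : Set X) : Prop :=
  ∀ Q : X → ZMod 2, (∀ s ∈ S, Q s = 1) →
    (∀ x y, Q (x + y) + Q x + Q y = ω x y) →
    ∀ χ : ZMod 2, ∀ α β : Module.Dual (ZMod 2) X,
      ∃ x, Q x + α x = χ ∧ Q x + β x = χ ∧ ω x ≠ α ∧ ω x ≠ β

/-- A basis `S` is *connecting*. -/
def IsConnecting {X : Type*} [AddCommGroup X] [Module (ZMod 2) X]
    (ω : X →ₗ[ZMod 2] X →ₗ[ZMod 2] ZMod 2) (S : Set X) : Prop :=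
  ∀ Q : X → ZMod 2, (∀ s ∈ S, Q s = 1) →
    (∀ x y, Q (x + y) + Q x + Q y = ω x y) →
    ∀ α : Module.Dual (ZMod 2) X, ∀ x y : X,
      (∃ g ∈ affTransvectionGroup ω S ⇑α, g x ≠ x) →
      (∃ g ∈ affTransvectionGroup ω S ⇑α, g y ≠ y) →
      ((∃ g ∈ affTransvectionGroup ω S ⇑α, g x = y) ↔ Q x + α x = Q y + α y)

/-- The alternating form with Gram matrix the adjacency matrix of `E₆`. -/
def e6Form (a b : Fin 6 → ZMod 2) : ZMod 2 :=
  a 0 * b 1 + a 1 * b 0 + (a 1 * b 2 + a 2 * b 1) + (a 2 * b 3 + a 3 * b 2) +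
    (a 3 * b 4 + a 4 * b 3) + (a 2 * b 5 + a 5 * b 2)

/-- The quadratic form polarizing to `e6Form` which takes the value `1` on the standard basis. -/
def e6Quad (a : Fin 6 → ZMod 2) : ZMod 2 :=
  a 0 + a 1 + a 2 + a 3 + a 4 + a 5 +
    (a 0 * a 1 + a 1 * a 2 + a 2 * a 3 + a 3 * a 4 + a 2 * a 5)

/-- The transvection of `Fin 6 → ZMod 2` along the `i`-th standard basis vector. -/
def e6Refl (i : Fin 6) (a : Fin 6 → ZMod 2) : Fin 6 → ZMod 2 :=
  a + e6Form a (Pi.single i 1) • Pi.single i 1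

theorem e6_exists_of_values : ∀ d : Fin 6 → ZMod 2, ∀ χ ε : ZMod 2, ε = 0 ∨ d ≠ 0 →
    ∃ u, e6Quad u = χ ∧ e6Form d u = ε ∧ u ≠ 0 ∧ u ≠ d := by
  set_option maxRecDepth 100000 in
  decide +kernel

/-- The distance of a nonzero vector to a fixed representative of its orbit under the
transvections `e6Refl`, tabulated by binary expansion. -/
def e6Dist (a : Fin 6 → ZMod 2) : ℕ :=
  [0, 5, 5, 4, 5, 4, 4, 3, 5, 2, 0, 1, 4, 3, 3, 2, 5, 4, 2, 3, 4, 5, 3, 4, 4, 3, 1, 2, 3, 4, 2, 1,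
    5, 6, 8, 7, 4, 5, 3, 2, 8, 3, 3, 2, 3, 4, 2, 1, 6, 3, 3, 2, 5, 4, 4, 5, 7, 2, 2, 1, 2, 5, 1,
    0].getD (∑ i, (a i).val * 2 ^ (i : ℕ)) 0

/-- A representative of the orbit of nonzero vectors on which `e6Quad` takes the value `χ`. -/
def e6Rep (χ : ZMod 2) : Fin 6 → ZMod 2 :=
  ![χ, 1, χ, 1, χ, χ]

theorem e6_descent : ∀ a : Fin 6 → ZMod 2, a ≠ 0 → a = e6Rep (e6Quad a) ∨
    ∃ i, e6Refl i a ≠ 0 ∧ e6Quad (e6Refl i a) = e6Quad a ∧ e6Dist (e6Refl i a) < e6Dist a := by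
  set_option maxRecDepth 100000 in
  decide +kernel

theorem e6Form_nondegenerate : ∀ a : Fin 6 → ZMod 2, a ≠ 0 → ∃ b, e6Form a b ≠ 0 := by
  set_option maxRecDepth 100000 in
  decide +kernel

section

variable {X : Type*} [AddCommGroup X] [Module (ZMod 2) X] (ω : X →ₗ[ZMod 2] X →ₗ[ZMod 2] ZMod 2)

theorem zero_or_one : ∀ c : ZMod 2, c = 0 ∨ c = 1 := by decide

theorem alternating_comm {ω : X →ₗ[ZMod 2] X →ₗ[ZMod 2] ZMod 2} (halt : ∀ x, ω x x = 0) (x y : X) :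
    ω x y = ω y x := by
  have h := halt (x + y)
  simp only [map_add, LinearMap.add_apply, halt, zero_add, add_zero] at h
  exact (CharTwo.add_eq_zero.mp h).symm

/-- `y` is the image of `x` under the affine transvection along some member of `A`. -/
def AffStep (A : Set X) (α : Module.Dual (ZMod 2) X) (x y : X) : Prop :=
  ∃ s ∈ A, y = x + (ω x s + α s) • s

/-- `y` is obtained from `x` by a sequence of affine transvections along members of `A`. -/
def AffReach (A : Set X) (α : Module.Dual (ZMod 2) X) : X → X → Prop :=
  Relation.ReflTransGen (AffStep ω A α)

/-- A strengthening of niceness, relative to a subspace `W`. -/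
def IsRich (Q : X → ZMod 2) (W : Submodule (ZMod 2) X) : Prop :=
  ∀ χ ε : ZMod 2, ∀ α γ : Module.Dual (ZMod 2) X, (ε = 0 ∨ ∃ w ∈ W, γ w ≠ 0) →
    ∃ u ∈ W, Q u + α u = χ ∧ γ u = ε ∧ (∃ w ∈ W, ω u w ≠ α w) ∧ ∃ w ∈ W, ω u w ≠ α w + γ w

/-- Points of `span A` not fixed by all transvections along `A` and with the same value of `Q + α`
can be joined by transvections along `A`. -/
def IsLinked (Q : X → ZMod 2) (A : Set X) : Prop :=
  ∀ α : Module.Dual (ZMod 2) X, ∀ x ∈ Submodule.span (ZMod 2) A,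
    ∀ y ∈ Submodule.span (ZMod 2) A,
    (∃ w ∈ Submodule.span (ZMod 2) A, ω x w ≠ α w) →
    (∃ w ∈ Submodule.span (ZMod 2) A, ω y w ≠ α w) →
    Q x + α x = Q y + α y → AffReach ω A α x y

variable {ω} {Q : X → ZMod 2} {A B : Set X} {α β : Module.Dual (ZMod 2) X} {x y s t : X}

theorem AffReach.mono (hAB : A ⊆ B) (h : AffReach ω A α x y) : AffReach ω B α x y :=
  Relation.ReflTransGen.mono (fun _ _ ⟨s, hs, h⟩ => ⟨s, hAB hs, h⟩) _ _ h

theorem AffStep.symm (halt : ∀ x, ω x x = 0) (h : AffStep ω A α x y) : AffStep ω A α y x := by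
  obtain ⟨s, hs, rfl⟩ := h
  refine ⟨s, hs, ?_⟩
  simp only [map_add, map_smul, LinearMap.add_apply, LinearMap.smul_apply, halt, smul_zero,
    add_zero]
  rw [add_assoc, ← add_smul, CharTwo.add_self_eq_zero, zero_smul, add_zero]

theorem AffReach.symm (halt : ∀ x, ω x x = 0) (h : AffReach ω A α x y) : AffReach ω A α y x := by
  have : Std.Symm (AffStep ω A α) := ⟨fun _ _ h => h.symm halt⟩
  exact Relation.ReflTransGen.stdSymm.symm _ _ h

theorem AffReach.translate (d : X) (hβ : ∀ s ∈ A, β s = α s + ω d s) (h : AffReach ω A β x y) :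
    AffReach ω A α (x + d) (y + d) := by
  refine Relation.ReflTransGen.lift (· + d) ?_ _ _ h
  rintro x y ⟨s, hs, rfl⟩
  refine ⟨s, hs, ?_⟩
  rw [hβ s hs, map_add, LinearMap.add_apply, add_right_comm, add_assoc (ω x s), add_comm (α s)]

theorem quad_zero (hQ : ∀ x y, Q (x + y) + Q x + Q y = ω x y) : Q 0 = 0 := by
  have := hQ 0 0
  simpa [CharTwo.add_self_eq_zero] using this

theorem quad_add (hQ : ∀ x y, Q (x + y) + Q x + Q y = ω x y) (x y : X) :
    Q (x + y) = Q x + Q y + ω x y := by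
  rw [← hQ]
  linear_combination (-Q x - Q y) * CharTwo.two_eq_zero (R := ZMod 2)

theorem quad_smul (hQ : ∀ x y, Q (x + y) + Q x + Q y = ω x y) (hs : Q s = 1) (c : ZMod 2) :
    Q (c • s) = c := by
  obtain rfl | rfl := zero_or_one c
  · rw [zero_smul, quad_zero hQ]
  · rw [one_smul, hs]

theorem AffStep.quad_eq (hQ : ∀ x y, Q (x + y) + Q x + Q y = ω x y) (hA : ∀ s ∈ A, Q s = 1)
    (h : AffStep ω A α x y) : Q y + α y = Q x + α x := by
  obtain ⟨s, hs, rfl⟩ := h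
  rw [quad_add hQ, quad_smul hQ (hA s hs)]
  simp only [map_add, map_smul, smul_eq_mul]
  generalize ω x s = a
  generalize α s = b
  generalize Q x = c
  generalize α x = d
  revert a b c d
  decide

theorem AffReach.quad_eq (hQ : ∀ x y, Q (x + y) + Q x + Q y = ω x y) (hA : ∀ s ∈ A, Q s = 1)
    (h : AffReach ω A α x y) : Q y + α y = Q x + α x := by
  induction h with
  | refl => rfl
  | tail _ h ih => rw [h.quad_eq hQ hA, ih]

/-! ### Enlarging a set of transvections by one element -/

theorem isRich_insert (hQ : ∀ x y, Q (x + y) + Q x + Q y = ω x y) (ht : Q t = 1)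
    (h : IsRich ω Q (Submodule.span (ZMod 2) A)) :
    IsRich ω Q (Submodule.span (ZMod 2) (insert t A)) := by
  intro χ ε α γ hεγ
  have hle : Submodule.span (ZMod 2) A ≤ Submodule.span (ZMod 2) (insert t A) :=
    Submodule.span_mono (Set.subset_insert t A)
  by_cases hγ : ε = 0 ∨ ∃ w ∈ Submodule.span (ZMod 2) A, γ w ≠ 0
  · obtain ⟨u, hu, h1, h2, ⟨w, hw, h3⟩, ⟨v, hv, h4⟩⟩ := h χ ε α γ hγ
    exact ⟨u, hle hu, h1, h2, ⟨w, hle hw, h3⟩, ⟨v, hle hv, h4⟩⟩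
  · push Not at hγ
    obtain ⟨hε, hγ⟩ := hγ
    have hγt : γ t ≠ 0 := by
      intro h0
      obtain ⟨w, hw, hne⟩ := hεγ.resolve_left hε
      obtain ⟨c, z, hz, rfl⟩ := Submodule.mem_span_insert.mp hw
      exact hne (by simp [h0, hγ z hz])
    obtain ⟨u, hu, h1, -, ⟨w, hw, h3⟩, -⟩ := h (χ + 1 + α t) 0 (α + ω t) 0 (Or.inl rfl)
    have hwt : ω (u + t) w ≠ α w := by
      rw [map_add, LinearMap.add_apply]
      rw [LinearMap.add_apply] at h3
      contrapose! h3
      rw [← h3, add_assoc, CharTwo.add_self_eq_zero, add_zero]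
    refine ⟨u + t, add_mem (hle hu) (Submodule.subset_span (Set.mem_insert t A)), ?_, ?_,
      ⟨w, hle hw, hwt⟩, ⟨w, hle hw, by rwa [hγ w hw, add_zero]⟩⟩
    · have h5 := hQ t u
      rw [LinearMap.add_apply, ← h5, ht, add_comm t u] at h1
      rw [map_add]
      generalize Q (u + t) = a at *
      generalize Q u = b at *
      generalize α u = c at *
      generalize α t = d at *
      clear h5 hγt hwt h3
      revert a b c d χ
      decide
    · rw [map_add, hγ u hu, zero_add]
      generalize γ t = a at *
      clear h1 h3 hεγ hwt
      revert a ε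
      decide

theorem isLinked_insert (halt : ∀ x, ω x x = 0) (hQ : ∀ x y, Q (x + y) + Q x + Q y = ω x y)
    (hA : ∀ s ∈ A, Q s = 1) (ht : Q t = 1) (hst : ∃ s ∈ A, ω t s ≠ 0)
    (hrich : IsRich ω Q (Submodule.span (ZMod 2) A)) (h : IsLinked ω Q A) :
    IsLinked ω Q (insert t A) := by
  set W := Submodule.span (ZMod 2) A with hW
  have hA' : ∀ s ∈ insert t A, Q s = 1 := by
    rintro s (rfl | hs)
    exacts [ht, hA s hs]
  obtain ⟨s, hs, hts⟩ := hst
  have hsW : s ∈ W := Submodule.subset_span hs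
  intro α
  have layer : ∀ c : ZMod 2, ∀ u ∈ W, ∀ v ∈ W, (∃ w ∈ W, ω (u + c • t) w ≠ α w) →
      (∃ w ∈ W, ω (v + c • t) w ≠ α w) →
      Q (u + c • t) + α (u + c • t) = Q (v + c • t) + α (v + c • t) →
      AffReach ω (insert t A) α (u + c • t) (v + c • t) := by
    intro c u hu v hv hu' hv' huv
    have shift : ∀ u w, ω (u + c • t) w ≠ α w → ω u w ≠ (α + ω (c • t)) w := by
      intro u w hne
      contrapose! hne
      rw [map_add, LinearMap.add_apply, hne, LinearMap.add_apply, add_assoc,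
        CharTwo.add_self_eq_zero, add_zero]
    refine (AffReach.translate (c • t) (β := α + ω (c • t)) (fun _ _ => rfl)
      (h _ u hu v hv ?_ ?_ ?_)).mono (Set.subset_insert t A)
    · obtain ⟨w, hw, hne⟩ := hu'
      exact ⟨w, hw, shift u w hne⟩
    · obtain ⟨w, hw, hne⟩ := hv'
      exact ⟨w, hw, shift v w hne⟩
    · rw [quad_add hQ, quad_add hQ v, map_add, map_add] at huv
      rw [LinearMap.add_apply, LinearMap.add_apply, alternating_comm halt _ u,
        alternating_comm halt _ v]
      linear_combination huv
  have key : ∀ χ : ZMod 2, ∃ z, ∀ x ∈ Submodule.span (ZMod 2) (insert t A),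
      (∃ w ∈ Submodule.span (ZMod 2) (insert t A), ω x w ≠ α w) → Q x + α x = χ →
      AffReach ω (insert t A) α x z := by
    intro χ
    obtain ⟨z, hz, hzχ, hzt, ⟨w₀, hw₀, hne₀⟩, ⟨w₁, hw₁, hne₁⟩⟩ :=
      hrich χ (1 + α t) α (ω t) (Or.inr ⟨s, hsW, hts⟩)
    have hstep : AffStep ω (insert t A) α z (z + (1 : ZMod 2) • t) := by
      refine ⟨t, Set.mem_insert t A, ?_⟩
      rw [alternating_comm halt, hzt, add_assoc, CharTwo.add_self_eq_zero, add_zero]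
    have main : ∀ x ∈ Submodule.span (ZMod 2) (insert t A), (∃ w ∈ W, ω x w ≠ α w) →
        Q x + α x = χ → AffReach ω (insert t A) α x z := by
      intro x hx hxw hxχ
      obtain ⟨c, u, hu, rfl⟩ := Submodule.mem_span_insert.mp hx
      rw [add_comm (c • t) u] at hxw hxχ ⊢
      obtain rfl | rfl := zero_or_one c
      · have := layer 0 u hu z hz hxw ⟨w₀, hw₀, by simpa using hne₀⟩
          (by rw [hxχ]; simpa using hzχ.symm)
        simpa using this
      · refine (layer 1 u hu z hz hxw ⟨w₁, hw₁, ?_⟩ ?_).tail (hstep.symm halt)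
        · contrapose! hne₁
          rw [← hne₁, one_smul, map_add, LinearMap.add_apply, add_assoc,
            CharTwo.add_self_eq_zero, add_zero]
        · rw [hstep.quad_eq hQ hA', hxχ, hzχ]
    refine ⟨z, fun x hx hxw hxχ => ?_⟩
    by_cases hxW : ∃ w ∈ W, ω x w ≠ α w
    · exact main x hx hxW hxχ
    · push Not at hxW
      have hxt : ω x t + α t = 1 := by
        have : ω x t ≠ α t := by
          intro h0
          obtain ⟨w, hw, hne⟩ := hxw
          obtain ⟨c, v, hv, rfl⟩ := Submodule.mem_span_insert.mp hw
          exact hne (by rw [map_add, map_add, map_smul, map_smul, h0, hxW v hv])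
        generalize ω x t = a at *
        generalize α t = b at *
        clear hstep hzt
        revert a b
        decide
      have hxstep : AffStep ω (insert t A) α x (x + t) :=
        ⟨t, Set.mem_insert t A, by rw [hxt, one_smul]⟩
      refine Relation.ReflTransGen.head hxstep (main _ ?_ ⟨s, hsW, ?_⟩ ?_)
      · exact add_mem hx (Submodule.subset_span (Set.mem_insert t A))
      · rw [map_add, LinearMap.add_apply, hxW s hsW]
        simpa using hts
      · rw [hxstep.quad_eq hQ hA', hxχ]
  intro x hx y hy hxw hyw hxy
  obtain ⟨z, hz⟩ := key (Q x + α x)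
  exact (hz x hx hxw rfl).trans ((hz y hy hyw hxy.symm).symm halt)

/-! ### The base case `E₆` -/

theorem e6_form_eq {f : Fin 6 → X}
    (hf : ∀ i j, ω (f i) (f j) = e6Form (Pi.single i 1) (Pi.single j 1)) (a b : Fin 6 → ZMod 2) :
    ω (Fintype.linearCombination (ZMod 2) f a) (Fintype.linearCombination (ZMod 2) f b) =
      e6Form a b := by
  simp only [Fintype.linearCombination_apply, Fin.sum_univ_six, map_add, LinearMap.add_apply,
    map_smul, LinearMap.smul_apply, hf, e6Form, Pi.single_apply, smul_eq_mul]
  simp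
  ring

theorem e6_quad_eq (hQ : ∀ x y, Q (x + y) + Q x + Q y = ω x y) {f : Fin 6 → X}
    (hf : ∀ i j, ω (f i) (f j) = e6Form (Pi.single i 1) (Pi.single j 1)) (hf1 : ∀ i, Q (f i) = 1)
    (a : Fin 6 → ZMod 2) : Q (Fintype.linearCombination (ZMod 2) f a) = e6Quad a := by
  simp only [Fintype.linearCombination_apply, Fin.sum_univ_six, quad_add hQ, map_add,
    LinearMap.add_apply, map_smul, LinearMap.smul_apply, quad_smul hQ (hf1 _), hf, e6Form, e6Quad,
    Pi.single_apply, smul_eq_mul]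
  simp
  ring

/-- Every linear form agrees with some `ω c` on the span of an `E₆` configuration. -/
theorem exists_e6_representing (f : Fin 6 → X) (α : Module.Dual (ZMod 2) X) :
    ∃ c : Fin 6 → ZMod 2, ∀ b, α (Fintype.linearCombination (ZMod 2) f b) = e6Form c b := by
  refine ⟨![α (f 1) + α (f 5), α (f 0), α (f 5), α (f 4), α (f 3) + α (f 5),
    α (f 0) + α (f 2) + α (f 4)], fun b => ?_⟩
  simp only [Fintype.linearCombination_apply, Fin.sum_univ_six, map_add, map_smul, smul_eq_mul,
    e6Form]
  simp
  linear_combination (-(b 1 * α (f 5)) - b 2 * α (f 0) - b 2 * α (f 4) - b 3 * α (f 5)) *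
    CharTwo.two_eq_zero (R := ZMod 2)

theorem isRich_e6 (hQ : ∀ x y, Q (x + y) + Q x + Q y = ω x y) {f : Fin 6 → X}
    (hf : ∀ i j, ω (f i) (f j) = e6Form (Pi.single i 1) (Pi.single j 1))
    (hf1 : ∀ i, Q (f i) = 1) : IsRich ω Q (Submodule.span (ZMod 2) (Set.range f)) := by
  intro χ ε α γ hεγ
  rw [← Fintype.range_linearCombination (ZMod 2) f] at *
  set φ := Fintype.linearCombination (ZMod 2) f with hφ
  obtain ⟨c, hc⟩ := exists_e6_representing f α
  obtain ⟨d, hd⟩ := exists_e6_representing f γ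
  have hd0 : ε + e6Form d c = 0 ∨ d ≠ 0 := by
    by_cases h0 : d = 0
    · subst h0
      have hz : ∀ b, e6Form 0 b = 0 := fun b => by simp [e6Form]
      rcases hεγ with h | ⟨_, ⟨b, rfl⟩, h⟩
      · exact Or.inl (by rw [h, hz, add_zero])
      · exact absurd (by rw [hd, hz]) h
    · exact Or.inr h0
  obtain ⟨u, hu1, hu2, hu3, hu4⟩ :=
    e6_exists_of_values d (χ + e6Quad c) (ε + e6Form d c) hd0
  have nondeg : ∀ v w : Fin 6 → ZMod 2, v ≠ w → ∃ b, e6Form v b ≠ e6Form w b := by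
    intro v w hvw
    obtain ⟨b, hb⟩ := e6Form_nondegenerate (v - w) (sub_ne_zero.mpr hvw)
    refine ⟨b, fun h => hb ?_⟩
    simp only [e6Form, Pi.sub_apply] at h ⊢
    linear_combination h
  have hadd : ∀ v w b : Fin 6 → ZMod 2, e6Form (v + w) b = e6Form v b + e6Form w b := by
    intro v w b
    simp only [e6Form, Pi.add_apply]
    ring
  have hself : c + c = 0 := CharTwo.add_self_eq_zero c
  refine ⟨φ (u + c), ⟨_, rfl⟩, ?_, ?_, ?_, ?_⟩
  · rw [map_add, quad_add hQ, e6_quad_eq hQ hf hf1, e6_quad_eq hQ hf hf1, e6_form_eq hf, map_add,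
      hc, hc, hu1]
    have h1 : e6Form c c = 0 := by
      simp only [e6Form]
      linear_combination (c 0 * c 1 + c 1 * c 2 + c 2 * c 3 + c 3 * c 4 + c 2 * c 5) *
        CharTwo.two_eq_zero (R := ZMod 2)
    have h2 : e6Form c u = e6Form u c := by
      simp only [e6Form]
      ring
    rw [h1, h2]
    linear_combination (e6Quad c + e6Form u c) * CharTwo.two_eq_zero (R := ZMod 2)
  · have h1 : e6Form d (u + c) = e6Form d u + e6Form d c := by
      simp only [e6Form, Pi.add_apply]
      ring
    rw [hd, h1, hu2]
    linear_combination (e6Form d c) * CharTwo.two_eq_zero (R := ZMod 2)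
  · obtain ⟨b, hb⟩ := nondeg (u + c) c (by simpa using hu3)
    exact ⟨φ b, ⟨b, rfl⟩, by rwa [e6_form_eq hf, hc]⟩
  · obtain ⟨b, hb⟩ := nondeg (u + c) (c + d) (by rw [add_comm]; simpa using hu4)
    exact ⟨φ b, ⟨b, rfl⟩, by rwa [e6_form_eq hf, hc, hd, ← hadd]⟩

theorem affReach_e6Rep {f : Fin 6 → X}
    (hf : ∀ i j, ω (f i) (f j) = e6Form (Pi.single i 1) (Pi.single j 1)) (a : Fin 6 → ZMod 2)
    (ha : a ≠ 0) :
    AffReach ω (Set.range f) 0 (Fintype.linearCombination (ZMod 2) f a)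
      (Fintype.linearCombination (ZMod 2) f (e6Rep (e6Quad a))) := by
  induction hn : e6Dist a using Nat.strong_induction_on generalizing a with
  | _ n ih =>
    rcases e6_descent a ha with h | ⟨i, hi, hq, hlt⟩
    · rw [← h]
      exact .refl
    · have := ih _ (hn ▸ hlt) _ hi rfl
      rw [hq] at this
      refine Relation.ReflTransGen.head ⟨f i, ⟨i, rfl⟩, ?_⟩ this
      have h1 : Fintype.linearCombination (ZMod 2) f (Pi.single i 1) = f i := by
        simp
      rw [LinearMap.zero_apply, add_zero, e6Refl, map_add, map_smul, ← e6_form_eq hf, h1]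

theorem isLinked_e6 (halt : ∀ x, ω x x = 0) (hQ : ∀ x y, Q (x + y) + Q x + Q y = ω x y)
    {f : Fin 6 → X} (hf : ∀ i j, ω (f i) (f j) = e6Form (Pi.single i 1) (Pi.single j 1))
    (hf1 : ∀ i, Q (f i) = 1) : IsLinked ω Q (Set.range f) := by
  intro α x hx y hy hxw hyw hxy
  rw [← Fintype.range_linearCombination (ZMod 2) f] at *
  set φ := Fintype.linearCombination (ZMod 2) f with hφ
  obtain ⟨c, hc⟩ := exists_e6_representing f α
  have key : ∀ a, (∃ w ∈ LinearMap.range φ, ω (φ a) w ≠ α w) →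
      AffReach ω (Set.range f) α (φ a) (φ (e6Rep (Q (φ a) + α (φ a) + e6Quad c) + c)) := by
    rintro a ⟨_, ⟨b, rfl⟩, hb⟩
    have hac : a + c ≠ 0 := by
      intro h0
      rw [CharTwo.add_eq_zero] at h0
      exact hb (by rw [e6_form_eq hf, hc, h0])
    have hreach : AffReach ω (Set.range f) 0 (φ (a + c)) (φ (e6Rep (e6Quad (a + c)))) :=
      affReach_e6Rep hf (a + c) hac
    have hq : e6Quad (a + c) = Q (φ a) + α (φ a) + e6Quad c := by
      rw [← e6_quad_eq hQ hf hf1, map_add, quad_add hQ, alternating_comm halt, e6_form_eq hf,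
        hc a, e6_quad_eq hQ hf hf1 c]
      ring
    rw [hq] at hreach
    have := AffReach.translate (α := α) (φ c) (fun s hs => ?_) hreach
    · rwa [← map_add, ← map_add, add_assoc, CharTwo.add_self_eq_zero, add_zero] at this
    · obtain ⟨i, rfl⟩ := hs
      have h1 : φ (Pi.single i 1) = f i := by simp [hφ]
      rw [← h1, hc, e6_form_eq hf, CharTwo.add_self_eq_zero, LinearMap.zero_apply]
  obtain ⟨a, rfl⟩ := hx
  obtain ⟨b, rfl⟩ := hy
  have h1 := key a hxw
  have h2 := key b hyw
  rw [← hxy] at h2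
  exact h1.trans (h2.symm halt)

/-! ### Trees containing `E₆` -/

theorem e6_adj_iff : ∀ i j, e6Graph.Adj i j ↔
    e6Form (Pi.single i 1) (Pi.single j 1) ≠ 0 := by
  simp only [e6Graph, SimpleGraph.fromRel_adj]
  decide

theorem transGraph_adj (halt : ∀ x, ω x x = 0) (u v : A) :
    (transGraph ω A).Adj u v ↔ ω u v ≠ 0 := by
  rw [transGraph, SimpleGraph.fromRel_adj, alternating_comm halt v, or_self, and_iff_right_iff_imp]
  rintro h rfl
  exact h (halt _)

theorem isRich_isLinked_of_connected (halt : ∀ x, ω x x = 0)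
    (hQ : ∀ x y, Q (x + y) + Q x + Q y = ω x y) (hA : ∀ s ∈ A, Q s = 1) (hfin : A.Finite)
    (hconn : (transGraph ω A).Preconnected) (f : Fin 6 → A)
    (hf : ∀ i j, (transGraph ω A).Adj (f i) (f j) ↔ e6Graph.Adj i j) :
    IsRich ω Q (Submodule.span (ZMod 2) A) ∧ IsLinked ω Q A := by
  have hform : ∀ i j, ω (f i) (f j) = e6Form (Pi.single i 1) (Pi.single j 1) := by
    intro i j
    have := hf i j
    rw [transGraph_adj halt, e6_adj_iff] at this
    generalize ω (f i) (f j) = a at *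
    generalize e6Form (Pi.single i 1) (Pi.single j 1) = b at *
    revert a b
    decide
  have hone : ∀ i, Q (f i) = 1 := fun i => hA _ (f i).2
  let good : Set (Set X) := {B | Set.range (fun i => (f i : X)) ⊆ B ∧ B ⊆ A ∧
    IsRich ω Q (Submodule.span (ZMod 2) B) ∧ IsLinked ω Q B}
  have hgood : good.Finite := hfin.finite_subsets.subset fun B hB => hB.2.1
  have hne : good.Nonempty := ⟨Set.range (fun i => (f i : X)), subset_rfl,
    by rintro _ ⟨i, rfl⟩; exact (f i).2, isRich_e6 hQ hform hone, isLinked_e6 halt hQ hform hone⟩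
  obtain ⟨B, ⟨hfB, hBA, hrich, hlinked⟩, hmax⟩ := hgood.exists_maximal hne
  suffices A ⊆ B by
    obtain rfl := hBA.antisymm this
    exact ⟨hrich, hlinked⟩
  intro v hv
  by_contra hvB
  obtain ⟨p⟩ := hconn (f 0) ⟨v, hv⟩
  obtain ⟨d, -, hd1, hd2⟩ := p.exists_boundary_dart {u | (u : X) ∈ B} (hfB ⟨0, rfl⟩) hvB
  have hadj := (transGraph_adj halt _ _).mp d.adj
  rw [alternating_comm halt] at hadj
  have hB1 : ∀ s ∈ B, Q s = 1 := fun s hs => hA s (hBA hs)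
  have ht1 := hA _ d.snd.2
  refine hd2 (hmax (y := insert (d.snd : X) B) ⟨hfB.trans (Set.subset_insert _ _),
    Set.insert_subset d.snd.2 hBA, isRich_insert hQ ht1 hrich,
    isLinked_insert halt hQ hB1 ht1 ⟨_, hd1, hadj⟩ hrich hlinked⟩
    (Set.subset_insert _ _) (Set.mem_insert _ _))

/-! ### Invariance under t-equivalence -/

theorem tStep.quad_eq_one (hQ : ∀ x y, Q (x + y) + Q x + Q y = ω x y) (h : tStep ω A B)
    (hA : ∀ s ∈ A, Q s = 1) : ∀ s ∈ B, Q s = 1 := by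
  obtain ⟨s, hs, t, ht, -, hst, rfl⟩ := h
  rintro u (rfl | hu)
  · rw [quad_add hQ, hA s hs, hA t ht, hst]
    decide
  · exact hA u hu.1

theorem tStep.finite (h : tStep ω A B) (hA : A.Finite) : B.Finite := by
  obtain ⟨s, hs, t, ht, -, hst, rfl⟩ := h
  exact hA.sdiff.insert _

theorem tStep.span_eq_top (h : tStep ω A B) (hA : Submodule.span (ZMod 2) A = ⊤) :
    Submodule.span (ZMod 2) B = ⊤ := by
  obtain ⟨s, hs, t, ht, hne, hst, rfl⟩ := h
  rw [eq_top_iff, ← hA, Submodule.span_le]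
  intro u hu
  have hmem : ∀ u ∈ A, u ≠ t →
      u ∈ Submodule.span (ZMod 2) (insert (s + t) (A \ {t})) := fun u hu hut =>
    Submodule.subset_span (Set.mem_insert_of_mem _ ⟨hu, hut⟩)
  by_cases hut : u = t
  · have := sub_mem (Submodule.subset_span (Set.mem_insert (s + t) (A \ {t}))) (hmem s hs hne)
    rw [add_sub_cancel_left] at this
    rwa [hut]
  · exact hmem u hu hut

theorem tStep.affReach (halt : ∀ x, ω x x = 0) (h : tStep ω A B) (hB : AffReach ω B α x y) :
    AffReach ω A α x y := by
  obtain ⟨s, hs, t, ht, -, hst, rfl⟩ := h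
  induction hB with
  | refl => exact .refl
  | @tail x y _ hxy ih =>
    refine ih.trans ?_
    obtain ⟨u, rfl | hu, rfl⟩ := hxy
    · have hts : ω t s = 1 := by rw [alternating_comm halt, hst]
      refine ((Relation.ReflTransGen.single ⟨s, hs, rfl⟩).tail ⟨t, ht, rfl⟩).tail ⟨s, hs, ?_⟩
      simp only [map_add, map_smul, LinearMap.add_apply, LinearMap.smul_apply, halt, hst, hts,
        smul_eq_mul]
      generalize ω x s = a
      generalize ω x t = b
      generalize α s = c
      generalize α t = d
      match_scalars
      · ring
      · linear_combination (-a - c) * CharTwo.two_eq_zero (R := ZMod 2)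
      · ring
    · exact .single ⟨u, hu.1, rfl⟩

theorem AffReach.exists_mem_group (halt : ∀ x, ω x x = 0) (h : AffReach ω A α x y) :
    ∃ g ∈ affTransvectionGroup ω A α, g x = y := by
  induction h with
  | refl => exact ⟨1, one_mem _, rfl⟩
  | tail _ hstep ih =>
    obtain ⟨g, hg, rfl⟩ := ih
    obtain ⟨s, hs, rfl⟩ := hstep
    let T : X → X := fun x => x + (ω x s + α s) • s
    have hT : Function.Involutive T := by
      intro x
      simp only [T, map_add, map_smul, LinearMap.add_apply, LinearMap.smul_apply, halt, smul_zero,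
        add_zero]
      rw [add_assoc, ← add_smul, CharTwo.add_self_eq_zero, zero_smul, add_zero]
    refine ⟨hT.toPerm * g, mul_mem (Subgroup.subset_closure ⟨s, hs, 1, one_ne_zero, fun x => ?_⟩) hg,
      rfl⟩
    rw [one_mul]
    rfl

theorem quad_eq_of_mem_group (hQ : ∀ x y, Q (x + y) + Q x + Q y = ω x y)
    (hA : ∀ s ∈ A, Q s = 1) {g : Equiv.Perm X} (hg : g ∈ affTransvectionGroup ω A α) (x : X) :
    Q (g x) + α (g x) = Q x + α x := by
  induction hg using Subgroup.closure_induction generalizing x with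
  | mem g hg =>
    obtain ⟨s, hs, k, hk, hg⟩ := hg
    obtain rfl : k = 1 := (zero_or_one k).resolve_left hk
    exact AffStep.quad_eq hQ hA ⟨s, hs, by rw [hg, one_mul]⟩
  | one => rfl
  | mul g h _ _ ihg ihh => rw [Equiv.Perm.mul_apply, ihg, ihh]
  | inv g _ ih => simpa using (ih (g⁻¹ x)).symm

theorem eq_of_mem_group_of_form_eq (h : ω x = α) {g : Equiv.Perm X}
    (hg : g ∈ affTransvectionGroup ω A α) : g x = x := by
  induction hg using Subgroup.closure_induction with
  | mem g hg =>
    obtain ⟨s, hs, k, hk, hg⟩ := hg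
    rw [hg, h, CharTwo.add_self_eq_zero, mul_zero, zero_smul, add_zero]
  | one => rfl
  | mul g h _ _ ihg ihh => rw [Equiv.Perm.mul_apply, ihh, ihg]
  | inv g _ ih => rw [Equiv.Perm.inv_eq_iff_eq, ih]

theorem tEquiv_transfer (halt : ∀ x, ω x x = 0)
    (hQ : ∀ x y, Q (x + y) + Q x + Q y = ω x y) (h : tEquiv ω A B) (hA : ∀ s ∈ A, Q s = 1)
    (hfin : A.Finite) (hspan : Submodule.span (ZMod 2) A = ⊤) :
    (∀ s ∈ B, Q s = 1) ∧ B.Finite ∧ Submodule.span (ZMod 2) B = ⊤ ∧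
      ∀ α x y, AffReach ω B α x y → AffReach ω A α x y := by
  induction h with
  | refl => exact ⟨hA, hfin, hspan, fun _ _ _ h => h⟩
  | tail _ hstep ih =>
    obtain ⟨h1, h2, h3, h4⟩ := ih
    exact ⟨hstep.quad_eq_one hQ h1, hstep.finite h2, hstep.span_eq_top h3,
      fun α x y h => h4 α x y (hstep.affReach halt h)⟩

end

/-- over `K = 𝔽₂`, every basis of `X` of orthogonal type is
nice and connecting. -/
theorem stmt16 {X : Type*} [AddCommGroup X] [Module (ZMod 2) X]
    [FiniteDimensional (ZMod 2) X]
    (ω : X →ₗ[ZMod 2] X →ₗ[ZMod 2] ZMod 2) (halt : ∀ x, ω x x = 0)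
    (S : Set X) (hind : LinearIndependent (ZMod 2) ((↑) : S → X))
    (hspan : Submodule.span (ZMod 2) S = ⊤)
    (horth : IsOrthogonalType ω S) :
    IsNice ω S ∧ IsConnecting ω S := by
  obtain ⟨S', hS', htree, f, -, hf⟩ := horth
  have hfin : S.Finite := hind.setFinite
  constructor
  · intro Q hS hQ χ α β
    obtain ⟨hS1, hfin', hspan', -⟩ := tEquiv_transfer halt hQ hS' hS hfin hspan
    obtain ⟨hrich, -⟩ :=
      isRich_isLinked_of_connected halt hQ hS1 hfin' htree.connected.preconnected f hf
    obtain ⟨u, -, h1, h2, ⟨w, -, h3⟩, ⟨v, -, h4⟩⟩ := hrich χ 0 α (β - α) (Or.inl rfl)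
    rw [LinearMap.sub_apply, sub_eq_zero] at h2
    refine ⟨u, h1, by rw [h2, h1], fun h => h3 (by rw [h]), fun h => h4 ?_⟩
    rw [h, LinearMap.sub_apply, add_sub_cancel]
  · intro Q hS hQ α x y hx hy
    obtain ⟨hS1, hfin', hspan', hreach⟩ := tEquiv_transfer halt hQ hS' hS hfin hspan
    obtain ⟨-, hlinked⟩ :=
      isRich_isLinked_of_connected halt hQ hS1 hfin' htree.connected.preconnected f hf
    have moved : ∀ x, (∃ g ∈ affTransvectionGroup ω S α, g x ≠ x) →
        ∃ w ∈ Submodule.span (ZMod 2) S', ω x w ≠ α w := by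
      rintro x ⟨g, hg, hne⟩
      by_contra! h
      refine hne (eq_of_mem_group_of_form_eq (LinearMap.ext fun w => h w ?_) hg)
      rw [hspan']
      trivial
    constructor
    · rintro ⟨g, hg, rfl⟩
      exact (quad_eq_of_mem_group hQ hS hg x).symm
    · intro hxy
      exact (hreach α x y (hlinked α x (hspan' ▸ trivial) y (hspan' ▸ trivial) (moved x hx)
        (moved y hy) hxy)).exists_mem_group halt
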